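/- arXiv:2306.07406 — 7 statements merged into one kernel-verified Lean document; each statement's English description precedes it below -/
import Mathlib

section
/- For every integer d ≥ 1 and every real x ≥ 0, the function m satisfies 1 − (2/π) ∫₀^π (sin t)/t dt ≤ m(x) ≤ 1; in particular sup_{x ≥ 0} |m(x)| = m(0) = 1. -/
open MeasureTheory Real Filter Finset

/-- Bessel function of the first kind of order `α`, via the Poisson integral representation. -/
noncomputable def besselJ (α : ℝ) (t : ℝ) : ℝ :=
  ((t / 2) ^ α / (Real.sqrt π * Real.Gamma (α + 1 / 2))) *
    ∫ θ in (0:ℝ)..π, Real.cos (t * Real.cos θ) * Real.sin θ ^ (2 * α)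

/-- The multiplier `m`, defined by an improper integral (as a limit of interval integrals). -/
noncomputable def mfun (d : ℕ) (x : ℝ) : ℝ :=
  (2 ^ ((d : ℝ) / 2) * Real.Gamma (((d : ℝ) + 1) / 2) / Real.sqrt π) *
    limUnder Filter.atTop
      (fun R : ℝ => ∫ r in (2 * π * x)..R, r ^ (-(d : ℝ) / 2) * besselJ ((d : ℝ) / 2) r)


/-- The sine integral `Si t = ∫₀ᵗ sin s / s ds`. -/
noncomputable def sinInt (t : ℝ) : ℝ := ∫ s in (0:ℝ)..t, sinc s

lemma hasDerivAt_sinInt (t : ℝ) : HasDerivAt sinInt (sinc t) t :=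
  (continuous_sinc.integral_hasStrictDerivAt 0 t).hasDerivAt

@[fun_prop]
lemma continuous_sinInt : Continuous sinInt :=
  continuous_iff_continuousAt.2 fun t => (hasDerivAt_sinInt t).continuousAt

@[simp]
lemma sinInt_zero : sinInt 0 = 0 := by simp [sinInt]

lemma sinInt_neg (t : ℝ) : sinInt (-t) = -sinInt t := by
  have h := intervalIntegral.integral_comp_neg (a := 0) (b := t) sinc
  simp only [sinc_neg, neg_zero] at h
  rw [sinInt, intervalIntegral.integral_symm, ← h, sinInt]

lemma sinInt_eq_integral_sin_div (t : ℝ) : sinInt t = ∫ s in (0:ℝ)..t, sin s / s := by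
  refine intervalIntegral.integral_congr_ae ?_
  filter_upwards [compl_mem_ae_iff.2 (measure_singleton (0:ℝ))] with s hs _
  exact sinc_of_ne_zero hs

lemma sinInt_nonneg {t : ℝ} (ht : 0 ≤ t) : 0 ≤ sinInt t := by
  have hmono : MonotoneOn (fun s => sinInt s - sin (s / 2) * sinc (s / 2)) (Set.Ici 0) := by
    refine monotoneOn_of_hasDerivWithinAt_nonneg (f' := fun s => (1 - cos s) / s ^ 2)
      (convex_Ici 0) (by have := continuous_sinc; fun_prop) ?_ ?_
    · intro s hs
      rw [interior_Ici, Set.mem_Ioi] at hs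
      have h : HasDerivAt (fun s => sinInt s - (1 - cos s) / s)
          (sinc s - ((0 - -sin s) * s - (1 - cos s) * 1) / s ^ 2) s :=
        (hasDerivAt_sinInt s).sub
          ((((hasDerivAt_const s (1:ℝ)).sub (hasDerivAt_cos s))).div (hasDerivAt_id s) hs.ne')
      rw [sinc_of_ne_zero hs.ne'] at h
      refine HasDerivAt.hasDerivWithinAt ((h.congr_deriv ?_).congr_of_eventuallyEq ?_)
      · field_simp
        ring
      · filter_upwards [lt_mem_nhds hs] with u hu
        rw [sinc_of_ne_zero (by positivity)]
        have h2 : cos u = 1 - 2 * sin (u / 2) ^ 2 := by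
          rw [← cos_two_mul_eq_one_sub]
          ring_nf
        rw [h2]
        field_simp
        ring
    · intro s _
      have := cos_le_one s
      exact div_nonneg (by linarith) (sq_nonneg s)
  have h := hmono (Set.self_mem_Ici) ht ht
  have h2 : 0 ≤ sin (t / 2) * sinc (t / 2) := by
    rcases eq_or_ne t 0 with rfl | h0
    · simp
    · rw [sinc_of_ne_zero (by positivity), mul_div_assoc']
      exact div_nonneg (mul_self_nonneg _) (by linarith)
  simp only [sinInt_zero, zero_div, sin_zero, zero_mul, sub_zero] at h
  linarith

lemma antitoneOn_sinInt_add :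
    AntitoneOn (fun s => sinInt s + (1 + cos s) / s) (Set.Ici π) := by
  have hd : ∀ s : ℝ, 0 < s → HasDerivAt (fun s => sinInt s + (1 + cos s) / s)
      (-(1 + cos s) / s ^ 2) s := by
    intro s hs
    have h : HasDerivAt (fun s => sinInt s + (1 + cos s) / s)
        (sinc s + ((0 + -sin s) * s - (1 + cos s) * 1) / s ^ 2) s :=
      (hasDerivAt_sinInt s).add
        ((((hasDerivAt_const s (1:ℝ)).add (hasDerivAt_cos s))).div (hasDerivAt_id s) hs.ne')
    rw [sinc_of_ne_zero hs.ne'] at h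
    refine h.congr_deriv ?_
    field_simp
    ring
  refine antitoneOn_of_hasDerivWithinAt_nonpos (f' := fun s => -(1 + cos s) / s ^ 2)
    (convex_Ici π) ?_ ?_ ?_
  · exact fun s hs => (hd s (pi_pos.trans_le hs)).continuousAt.continuousWithinAt
  · exact fun s hs => (hd s (pi_pos.trans_le (interior_subset hs))).hasDerivWithinAt
  · intro s _
    have := neg_one_le_cos s
    exact div_nonpos_of_nonpos_of_nonneg (by linarith) (sq_nonneg s)

lemma sinInt_le_sinInt_pi {t : ℝ} (ht : 0 ≤ t) : sinInt t ≤ sinInt π := by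
  rcases le_total t π with h | h
  · have hmono : MonotoneOn sinInt (Set.Icc 0 π) := by
      refine monotoneOn_of_hasDerivWithinAt_nonneg (f' := sinc) (convex_Icc 0 π)
        (by fun_prop) (fun s _ => (hasDerivAt_sinInt s).hasDerivWithinAt) ?_
      intro s hs
      rw [interior_Icc] at hs
      rw [sinc_of_ne_zero hs.1.ne']
      exact div_nonneg (sin_nonneg_of_nonneg_of_le_pi hs.1.le hs.2.le) hs.1.le
    exact hmono ⟨ht, h⟩ ⟨pi_pos.le, le_rfl⟩ h
  · have := antitoneOn_sinInt_add Set.self_mem_Ici h h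
    simp only [cos_pi, add_neg_cancel, zero_div, add_zero] at this
    have h2 := neg_one_le_cos t
    have h3 : 0 ≤ (1 + cos t) / t := div_nonneg (by linarith) ht
    linarith

lemma sinInt_le_self {t : ℝ} (ht : 0 ≤ t) : sinInt t ≤ t := by
  have h := intervalIntegral.integral_mono_on (μ := volume) (f := sinc) (g := fun _ => 1) ht
    (continuous_sinc.intervalIntegrable _ _) (by simp) (fun s _ => sinc_le_one s)
  simpa [sinInt] using h

lemma exists_tendsto_sinInt : ∃ L, Tendsto sinInt atTop (nhds L) := by
  have hanti : Antitone (fun s => sinInt (max π s) + (1 + cos (max π s)) / max π s) :=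
    fun a b hab => antitoneOn_sinInt_add (le_max_left π a) (le_max_left π b)
      (max_le_max_left π hab)
  have hbdd : BddBelow
      (Set.range fun s => sinInt (max π s) + (1 + cos (max π s)) / max π s) := by
    refine ⟨0, ?_⟩
    rintro _ ⟨s, rfl⟩
    have hs : 0 ≤ max π s := pi_pos.le.trans (le_max_left _ _)
    have := neg_one_le_cos (max π s)
    exact add_nonneg (sinInt_nonneg hs) (div_nonneg (by linarith) hs)
  have h0 : Tendsto (fun s : ℝ => (1 + cos s) / s) atTop (nhds 0) := by
    refine squeeze_zero_norm' (a := fun s : ℝ => 2 / s) ?_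
      (tendsto_const_nhds.div_atTop tendsto_id)
    filter_upwards [eventually_gt_atTop 0] with s hs
    rw [norm_div, norm_of_nonneg hs.le]
    gcongr
    rw [norm_eq_abs, abs_le]
    constructor <;> linarith [neg_one_le_cos s, cos_le_one s]
  refine ⟨_, ((tendsto_atTop_ciInf hanti hbdd).sub h0).congr' ?_⟩
  · filter_upwards [eventually_ge_atTop π] with s hs
    rw [max_eq_right hs]
    ring

/-- The **Riemann–Lebesgue lemma** for sine integrals over a bounded interval. -/
lemma tendsto_integral_sin_mul {a b : ℝ} (hab : a ≤ b) {g : ℝ → ℝ}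
    (hg : IntervalIntegrable g volume a b) :
    Tendsto (fun w : ℝ => ∫ x in a..b, sin (w * x) * g x) atTop (nhds 0) := by
  rw [intervalIntegrable_iff_integrableOn_Ioc_of_le hab] at hg
  have hf : Integrable ((Set.Ioc a b).indicator fun x => (g x : ℂ)) :=
    (integrable_indicator_iff measurableSet_Ioc).2 hg.ofReal
  have h := (Real.tendsto_integral_exp_smul_cocompact
    ((Set.Ioc a b).indicator fun x => (g x : ℂ))).mono_left atTop_le_cocompact
  have h2 := ((Complex.continuous_im.tendsto 0).comp h).comp
    (tendsto_id.atTop_div_const (by positivity : 0 < 2 * π))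
  have h3 := h2.neg
  rw [Complex.zero_im, neg_zero] at h3
  refine h3.congr fun w => ?_
  have hint : Integrable fun v : ℝ => Real.fourierChar (-(v * (w / (2 * π)))) •
      (Set.Ioc a b).indicator (fun x => (g x : ℂ)) v :=
    ((Real.fourierIntegral_convergent_iff (w / (2 * π))).2 hf).congr
      (ae_of_all _ fun v => by simp [mul_comm])
  have him : (∫ v : ℝ, Real.fourierChar (-(v * (w / (2 * π)))) •
      (Set.Ioc a b).indicator (fun x => (g x : ℂ)) v).im =
      ∫ v : ℝ, (Real.fourierChar (-(v * (w / (2 * π)))) •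
      (Set.Ioc a b).indicator (fun x => (g x : ℂ)) v).im := (integral_im hint).symm
  simp only [Function.comp_apply, id_eq]
  rw [him, ← integral_neg, intervalIntegral.integral_of_le hab,
    ← integral_indicator measurableSet_Ioc]
  refine integral_congr_ae (ae_of_all _ fun v => ?_)
  by_cases hv : v ∈ Set.Ioc a b
  · have hw : 2 * π * -(v * (w / (2 * π))) = -(w * v) := by field_simp
    simp only [Set.indicator_of_mem hv, Circle.smul_def, Real.fourierChar_apply, smul_eq_mul,
      Complex.im_mul_ofReal, hw, Complex.exp_ofReal_mul_I_im, sin_neg]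
    ring
  · simp [Set.indicator_of_notMem hv]

lemma intervalIntegrable_inv_sub_inv_sin :
    IntervalIntegrable (fun x : ℝ => 1 / x - 1 / sin x) volume 0 (π / 2) := by
  rw [intervalIntegrable_iff_integrableOn_Ioc_of_le (by positivity)]
  refine Integrable.mono' (g := fun _ => (1:ℝ)) (by simp) (by fun_prop) ?_
  refine (ae_restrict_iff' measurableSet_Ioc).2 (ae_of_all _ fun x hx => ?_)
  have hx0 := hx.1
  have hs := sin_pos_of_pos_of_lt_pi hx0 (by linarith [hx.2, pi_pos])
  have h1 := mul_le_sin hx0.le hx.2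
  have h2 := sin_gt_sub_cube hx0
  have h3 := sin_lt hx0
  have h4 : 1 / x - 1 / sin x = -((x - sin x) / (x * sin x)) := by
    field_simp
    ring
  rw [h4, norm_neg, norm_of_nonneg (div_nonneg (by linarith) (by positivity)),
    div_le_one (by positivity)]
  have h5 : x * (2 / π * x) ≤ x * sin x := by gcongr
  have h6 : 1 / 2 ≤ 2 / π := by
    rw [div_le_div_iff₀ (by norm_num) pi_pos]
    linarith [pi_le_four]
  have h7 : x ≤ 2 := by linarith [hx.2, pi_le_four]
  have h8 : 1 / 2 * (x * x) ≤ 2 / π * (x * x) := by gcongr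
  have h9 : x ^ 3 ≤ 2 * (x * x) := by nlinarith [mul_pos hx0 hx0]
  nlinarith

/-- The closed form of the Dirichlet kernel `1 + 2 ∑_{k=1}^n cos (2 k x)`. -/
lemma dirichletKernel_mul_sin (n : ℕ) (x : ℝ) :
    (1 + ∑ k ∈ range n, 2 * cos (2 * (k + 1) * x)) * sin x = sin ((2 * n + 1) * x) := by
  induction n with
  | zero => simp
  | succ n ih =>
    rw [sum_range_succ, ← add_assoc, add_mul, ih]
    have h1 : ((2 * (n:ℝ) + 1) * x) = 2 * (n + 1) * x - x := by ring
    have h2 : ((2 * ((n + 1 : ℕ):ℝ) + 1) * x) = 2 * (n + 1) * x + x := by push_cast; ring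
    rw [h1, h2, sin_sub, sin_add]
    ring

lemma integral_dirichletKernel (n : ℕ) :
    ∫ x in (0:ℝ)..π / 2, (1 + ∑ k ∈ range n, 2 * cos (2 * (k + 1) * x)) = π / 2 := by
  rw [intervalIntegral.integral_add (by simp)
    (Continuous.intervalIntegrable (by fun_prop) _ _), intervalIntegral.integral_finsetSum
    (fun k _ => Continuous.intervalIntegrable (by fun_prop) _ _)]
  have h : ∀ k ∈ range n, ∫ x in (0:ℝ)..π / 2, 2 * cos (2 * ((k:ℝ) + 1) * x) = 0 := by
    intro k _
    have hk : 2 * ((k:ℝ) + 1) ≠ 0 := by positivity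
    rw [intervalIntegral.integral_const_mul, intervalIntegral.integral_comp_mul_left _ hk,
      integral_cos]
    have : 2 * ((k:ℝ) + 1) * (π / 2) = ((k + 1 : ℕ) : ℝ) * π := by push_cast; ring
    rw [this, sin_nat_mul_pi]
    simp
  rw [sum_eq_zero h]
  simp

lemma sinInt_eq_pi_div_two_add (n : ℕ) :
    sinInt ((2 * n + 1) * (π / 2)) =
      π / 2 + ∫ x in (0:ℝ)..π / 2, sin ((2 * n + 1) * x) * (1 / x - 1 / sin x) := by
  have h1 : sinInt ((2 * n + 1) * (π / 2)) =
      ∫ x in (0:ℝ)..π / 2, (2 * n + 1) * sinc ((2 * n + 1) * x) := by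
    rw [intervalIntegral.integral_const_mul, intervalIntegral.mul_integral_comp_mul_left,
      mul_zero, sinInt]
  have := continuous_sinc
  rw [h1, ← sub_eq_iff_eq_add']
  nth_rw 2 [← integral_dirichletKernel n]
  rw [← intervalIntegral.integral_sub
    (Continuous.intervalIntegrable (by fun_prop) _ _)
    (Continuous.intervalIntegrable (by fun_prop) _ _)]
  refine intervalIntegral.integral_congr_ae (ae_of_all _ fun x hx => ?_)
  rw [Set.uIoc_of_le (by positivity)] at hx
  have hx0 := hx.1
  have hs := sin_pos_of_pos_of_lt_pi hx0 (by linarith [hx.2, pi_pos])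
  rw [sinc_of_ne_zero (by positivity), ← dirichletKernel_mul_sin]
  generalize 1 + ∑ k ∈ range n, 2 * cos (2 * ((k:ℝ) + 1) * x) = D
  field_simp

lemma tendsto_sinInt : Tendsto sinInt atTop (nhds (π / 2)) := by
  obtain ⟨L, hL⟩ := exists_tendsto_sinInt
  have hn : Tendsto (fun n : ℕ => 2 * (n:ℝ) + 1) atTop atTop :=
    tendsto_atTop_add_const_right _ _
      (tendsto_natCast_atTop_atTop.const_mul_atTop (by norm_num))
  have h1 := hL.comp (hn.atTop_mul_const (by positivity : 0 < π / 2))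
  have h2 := ((tendsto_integral_sin_mul (by positivity)
    intervalIntegrable_inv_sub_inv_sin).comp hn).const_add (π / 2)
  rw [add_zero] at h2
  rwa [tendsto_nhds_unique h1 (h2.congr fun n => (sinInt_eq_pi_div_two_add n).symm)] at hL

/-- The primitive in `R`, vanishing at `0`, of `∫₀^π cos (R cos θ) sin^n θ dθ`. -/
noncomputable def cosPrimitive (n : ℕ) (R : ℝ) : ℝ :=
  ∫ θ in (0:ℝ)..π, R * sinc (R * cos θ) * sin θ ^ n

lemma integral_cos_mul_eq_mul_sinc (c R : ℝ) :
    ∫ r in (0:ℝ)..R, cos (r * c) = R * sinc (R * c) := by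
  rcases eq_or_ne c 0 with rfl | hc
  · simp
  · rcases eq_or_ne R 0 with rfl | hR
    · simp
    · rw [intervalIntegral.integral_comp_mul_right _ hc, integral_cos,
        sinc_of_ne_zero (mul_ne_zero hR hc)]
      simp
      field_simp

lemma integral_integral_cos_mul_sin_pow (n : ℕ) (R : ℝ) :
    ∫ r in (0:ℝ)..R, ∫ θ in (0:ℝ)..π, cos (r * cos θ) * sin θ ^ n = cosPrimitive n R := by
  rw [intervalIntegral_intervalIntegral_swap]
  · simp_rw [intervalIntegral.integral_mul_const, integral_cos_mul_eq_mul_sinc]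
    rfl
  · refine IntegrableOn.mono_set (Continuous.continuousOn ?_ |>.integrableOn_compact
      (isCompact_uIcc.prod isCompact_uIcc))
      (Set.prod_mono Set.uIoc_subset_uIcc Set.uIoc_subset_uIcc)
    simp only [Function.uncurry_def]
    fun_prop

lemma integral_cos_mul_sin_pow_interval (n : ℕ) (a R : ℝ) :
    ∫ r in a..R, ∫ θ in (0:ℝ)..π, cos (r * cos θ) * sin θ ^ n =
      cosPrimitive n R - cosPrimitive n a := by
  have hc : Continuous fun r : ℝ => ∫ θ in (0:ℝ)..π, cos (r * cos θ) * sin θ ^ n :=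
    intervalIntegral.continuous_parametric_intervalIntegral_of_continuous' (by fun_prop) _ _
  rw [← integral_integral_cos_mul_sin_pow, ← integral_integral_cos_mul_sin_pow,
    intervalIntegral.integral_interval_sub_left (hc.intervalIntegrable _ _)
      (hc.intervalIntegrable _ _)]

lemma rpow_mul_besselJ (d : ℕ) {r : ℝ} (hr : 0 < r) :
    r ^ (-(d : ℝ) / 2) * besselJ ((d : ℝ) / 2) r =
      (2 ^ ((d : ℝ) / 2) * √π * Gamma (((d : ℝ) + 1) / 2))⁻¹ *
        ∫ θ in (0:ℝ)..π, cos (r * cos θ) * sin θ ^ d := by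
  have h1 : (d : ℝ) / 2 + 1 / 2 = ((d : ℝ) + 1) / 2 := by ring
  have h2 : 2 * ((d : ℝ) / 2) = d := by ring
  have h3 := rpow_pos_of_pos hr ((d : ℝ) / 2)
  have h4 := rpow_pos_of_pos (two_pos : (0:ℝ) < 2) ((d : ℝ) / 2)
  have h5 : 0 < Gamma (((d : ℝ) + 1) / 2) := Gamma_pos_of_pos (by positivity)
  rw [besselJ, h1, h2, neg_div, rpow_neg hr.le, div_rpow hr.le zero_le_two]
  simp_rw [rpow_natCast]
  field_simp

lemma cosPrimitive_zero (n : ℕ) : cosPrimitive n 0 = 0 := by simp [cosPrimitive]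

lemma cos_mul_sinInt (R θ : ℝ) :
    cos θ * sinInt (R * cos θ) = |cos θ| * sinInt (R * |cos θ|) := by
  rcases abs_cases (cos θ) with ⟨h, _⟩ | ⟨h, _⟩ <;> rw [h]
  rw [mul_neg, sinInt_neg]
  ring

lemma cosPrimitive_succ (n : ℕ) (R : ℝ) :
    cosPrimitive (n + 1) R = 2 * 0 ^ n * sinInt R +
      ∫ θ in (0:ℝ)..π, n * sin θ ^ (n - 1) * |cos θ| * sinInt (R * |cos θ|) := by
  have := continuous_sinc
  have h := intervalIntegral.integral_mul_deriv_eq_deriv_mul (a := 0) (b := π)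
    (u := fun θ => sin θ ^ n) (u' := fun θ => n * sin θ ^ (n - 1) * cos θ)
    (v := fun θ => -sinInt (R * cos θ)) (v' := fun θ => sinc (R * cos θ) * (R * sin θ))
    (fun θ _ => (hasDerivAt_sin θ).pow n)
    (fun θ _ => by
      have h := ((hasDerivAt_sinInt (R * cos θ)).comp θ ((hasDerivAt_cos θ).const_mul R)).neg
      exact h.congr_deriv (by ring))
    (Continuous.intervalIntegrable (by fun_prop) _ _)
    (Continuous.intervalIntegrable (by fun_prop) _ _)
  have h2 : cosPrimitive (n + 1) R =
      ∫ θ in (0:ℝ)..π, sin θ ^ n * (sinc (R * cos θ) * (R * sin θ)) :=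
    intervalIntegral.integral_congr fun θ _ => by
      ring
  rw [h2, h, sub_eq_add_neg, ← intervalIntegral.integral_neg]
  congr 1
  · simp only [sin_pi, sin_zero, cos_pi, cos_zero, mul_one, mul_neg, sinInt_neg]
    ring
  · refine intervalIntegral.integral_congr fun θ _ => ?_
    have := cos_mul_sinInt R θ
    linear_combination (n * sin θ ^ (n - 1)) * this

lemma integral_sin_pow_mul_abs_cos (n : ℕ) :
    2 * 0 ^ n + ∫ θ in (0:ℝ)..π, n * sin θ ^ (n - 1) * |cos θ| = 2 := by
  have hint : ∀ a b : ℝ,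
      IntervalIntegrable (fun θ => n * sin θ ^ (n - 1) * |cos θ|) volume a b :=
    fun a b => Continuous.intervalIntegrable (by fun_prop) _ _
  have hF : ∀ a b : ℝ, ∫ θ in a..b, n * sin θ ^ (n - 1) * cos θ = sin b ^ n - sin a ^ n :=
    fun a b => intervalIntegral.integral_eq_sub_of_hasDerivAt
      (fun θ _ => (hasDerivAt_sin θ).pow n) (Continuous.intervalIntegrable (by fun_prop) _ _)
  have h1 : ∫ θ in (0:ℝ)..π / 2, n * sin θ ^ (n - 1) * |cos θ| = 1 - 0 ^ n := by
    have : ∫ θ in (0:ℝ)..π / 2, n * sin θ ^ (n - 1) * |cos θ| =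
        ∫ θ in (0:ℝ)..π / 2, n * sin θ ^ (n - 1) * cos θ := by
      refine intervalIntegral.integral_congr fun θ hθ => ?_
      rw [Set.uIcc_of_le (by positivity)] at hθ
      rw [abs_of_nonneg (cos_nonneg_of_neg_pi_div_two_le_of_le
        (by linarith [hθ.1, pi_pos]) hθ.2)]
    rw [this, hF]
    simp
  have h2 : ∫ θ in (π / 2)..π, n * sin θ ^ (n - 1) * |cos θ| = 1 - 0 ^ n := by
    have : ∫ θ in (π / 2)..π, n * sin θ ^ (n - 1) * |cos θ| =
        ∫ θ in (π / 2)..π, -(n * sin θ ^ (n - 1) * cos θ) := by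
      refine intervalIntegral.integral_congr fun θ hθ => ?_
      rw [Set.uIcc_of_le (by linarith [pi_pos])] at hθ
      rw [abs_of_nonpos (cos_nonpos_of_pi_div_two_le_of_le hθ.1 (by linarith [hθ.2, pi_pos]))]
      ring
    rw [this, intervalIntegral.integral_neg, hF]
    simp
  rw [← intervalIntegral.integral_add_adjacent_intervals (hint 0 (π / 2)) (hint (π / 2) π),
    h1, h2]
  ring

lemma cosPrimitive_succ_nonneg (n : ℕ) {R : ℝ} (hR : 0 ≤ R) : 0 ≤ cosPrimitive (n + 1) R := by
  rw [cosPrimitive_succ]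
  refine add_nonneg (mul_nonneg (by positivity) (sinInt_nonneg hR))
    (intervalIntegral.integral_nonneg pi_pos.le fun θ hθ => ?_)
  have h1 := sin_nonneg_of_nonneg_of_le_pi hθ.1 hθ.2
  have h2 : 0 ≤ sinInt (R * |cos θ|) := sinInt_nonneg (by positivity)
  positivity

lemma cosPrimitive_succ_le (n : ℕ) {R : ℝ} (hR : 0 ≤ R) :
    cosPrimitive (n + 1) R ≤ 2 * sinInt π := by
  have h : ∫ θ in (0:ℝ)..π, n * sin θ ^ (n - 1) * |cos θ| * sinInt (R * |cos θ|) ≤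
      ∫ θ in (0:ℝ)..π, n * sin θ ^ (n - 1) * |cos θ| * sinInt π := by
    refine intervalIntegral.integral_mono_on pi_pos.le
      (Continuous.intervalIntegrable (by fun_prop) _ _)
      (Continuous.intervalIntegrable (by fun_prop) _ _) fun θ hθ => ?_
    have h1 := sin_nonneg_of_nonneg_of_le_pi hθ.1 hθ.2
    exact mul_le_mul_of_nonneg_left (sinInt_le_sinInt_pi (by positivity)) (by positivity)
  have h2 : 2 * 0 ^ n * sinInt R ≤ 2 * 0 ^ n * sinInt π :=
    mul_le_mul_of_nonneg_left (sinInt_le_sinInt_pi hR) (by positivity)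
  rw [intervalIntegral.integral_mul_const] at h
  rw [cosPrimitive_succ]
  have h3 := integral_sin_pow_mul_abs_cos n
  calc _ ≤ (2 * 0 ^ n + ∫ θ in (0:ℝ)..π, n * sin θ ^ (n - 1) * |cos θ|) * sinInt π := by
        linarith
    _ = _ := by rw [h3]

lemma tendsto_cosPrimitive_succ (n : ℕ) :
    Tendsto (cosPrimitive (n + 1)) atTop (nhds π) := by
  have h : Tendsto (fun R : ℝ =>
      ∫ θ in (0:ℝ)..π, n * sin θ ^ (n - 1) * |cos θ| * sinInt (R * |cos θ|)) atTop
      (nhds (∫ θ in (0:ℝ)..π, n * sin θ ^ (n - 1) * |cos θ| * (π / 2))) := by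
    refine intervalIntegral.tendsto_integral_filter_of_dominated_convergence
      (fun θ => n * sin θ ^ (n - 1) * |cos θ| * sinInt π)
      (Eventually.of_forall fun R => Continuous.aestronglyMeasurable (by fun_prop)) ?_
      (Continuous.intervalIntegrable (by fun_prop) _ _) (ae_of_all _ fun θ _ => ?_)
    · filter_upwards [eventually_ge_atTop 0] with R hR
      refine ae_of_all _ fun θ hθ => ?_
      rw [Set.uIoc_of_le pi_pos.le] at hθ
      have h1 := sin_nonneg_of_nonneg_of_le_pi hθ.1.le hθ.2
      have h2 : 0 ≤ sinInt (R * |cos θ|) := sinInt_nonneg (by positivity)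
      rw [norm_of_nonneg (by positivity)]
      exact mul_le_mul_of_nonneg_left (sinInt_le_sinInt_pi (by positivity)) (by positivity)
    · rcases eq_or_ne (cos θ) 0 with h0 | h0
      · simp [h0]
      · exact (tendsto_sinInt.comp
          (tendsto_id.atTop_mul_const (abs_pos.2 h0))).const_mul _
  rw [intervalIntegral.integral_mul_const] at h
  have h2 := (tendsto_sinInt.const_mul (2 * 0 ^ n)).add h
  rw [← add_mul, integral_sin_pow_mul_abs_cos, mul_div_cancel₀ _ two_ne_zero] at h2
  exact h2.congr fun R => (cosPrimitive_succ n R).symm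

lemma mfun_eq (n : ℕ) {x : ℝ} (hx : 0 ≤ x) :
    mfun (n + 1) x = 1 - cosPrimitive (n + 1) (2 * π * x) / π := by
  set d := n + 1 with hd
  set C := (2 ^ ((d : ℝ) / 2) * √π * Gamma (((d : ℝ) + 1) / 2))⁻¹ with hC
  have ha : 0 ≤ 2 * π * x := by positivity
  have hlim : Tendsto
      (fun R : ℝ => ∫ r in (2 * π * x)..R, r ^ (-(d : ℝ) / 2) * besselJ ((d : ℝ) / 2) r)
      atTop (nhds (C * (π - cosPrimitive d (2 * π * x)))) := by
    refine (((tendsto_cosPrimitive_succ n).sub_const _).const_mul C).congr' ?_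
    filter_upwards [eventually_ge_atTop (2 * π * x)] with R hR
    rw [← integral_cos_mul_sin_pow_interval, ← intervalIntegral.integral_const_mul]
    refine intervalIntegral.integral_congr_ae (ae_of_all _ fun r hr => ?_)
    rw [Set.uIoc_of_le hR] at hr
    exact (rpow_mul_besselJ d (ha.trans_lt hr.1)).symm
  rw [mfun, hlim.limUnder_eq, hC]
  have h4 := rpow_pos_of_pos (two_pos : (0:ℝ) < 2) ((d : ℝ) / 2)
  have h5 : 0 < Gamma (((d : ℝ) + 1) / 2) := Gamma_pos_of_pos (by positivity)
  have h6 : √π * √π = π := mul_self_sqrt pi_pos.le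
  generalize cosPrimitive d (2 * π * x) = P
  field_simp
  rw [sq, h6]

/-- For every integer `d ≥ 1` and every real `x ≥ 0`,
`1 − (2/π) ∫₀^π (sin t)/t dt ≤ m(x) ≤ 1`; in particular `sup_{x ≥ 0} |m(x)| = m(0) = 1`. -/
theorem statement0 (d : ℕ) (hd : 1 ≤ d) :
    (∀ x : ℝ, 0 ≤ x →
      1 - (2 / π) * (∫ t in (0:ℝ)..π, Real.sin t / t) ≤ mfun d x ∧ mfun d x ≤ 1) ∧
    (⨆ x : {x : ℝ // 0 ≤ x}, |mfun d x.1|) = mfun d 0 ∧ mfun d 0 = 1 := by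
  obtain ⟨n, rfl⟩ := Nat.exists_eq_add_of_le' hd
  have hbounds : ∀ x : ℝ, 0 ≤ x →
      1 - (2 / π) * sinInt π ≤ mfun (n + 1) x ∧ mfun (n + 1) x ≤ 1 := by
    intro x hx
    have ha : 0 ≤ 2 * π * x := by positivity
    rw [mfun_eq n hx]
    constructor
    · have := div_le_div_of_nonneg_right (cosPrimitive_succ_le n ha) pi_pos.le
      rw [mul_div_right_comm] at this
      linarith
    · linarith [div_nonneg (cosPrimitive_succ_nonneg n ha) pi_pos.le]
  have h0 : mfun (n + 1) 0 = 1 := by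
    rw [mfun_eq n le_rfl, mul_zero, cosPrimitive_zero]
    simp
  have hpi : (2 / π) * sinInt π ≤ 2 := by
    rw [div_mul_eq_mul_div, div_le_iff₀ pi_pos]
    linarith [sinInt_le_self pi_pos.le]
  have habs : ∀ x : {x : ℝ // 0 ≤ x}, |mfun (n + 1) x.1| ≤ 1 := fun x =>
    abs_le.2 ⟨by linarith [(hbounds x.1 x.2).1], (hbounds x.1 x.2).2⟩
  refine ⟨?_, ?_, h0⟩
  · rw [← sinInt_eq_integral_sin_div]
    exact hbounds
  · rw [h0]
    have : Nonempty {x : ℝ // 0 ≤ x} := ⟨⟨0, le_rfl⟩⟩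
    refine le_antisymm (ciSup_le habs) ?_
    refine le_trans ?_ (le_ciSup (f := fun x : {x : ℝ // 0 ≤ x} => |mfun (n + 1) x.1|)
      ⟨1, by rintro _ ⟨x, rfl⟩; exact habs x⟩ ⟨0, le_rfl⟩)
    simp [h0]
end

section
/- For every integer d ≥ 1 and every real x > 0, I(x) ≥ 0. -/
open MeasureTheory Real Filter

/-- The function `I(x) = (2/π) ∫₀^{2πx} (1 − (t/(2πx))²)^{(d−1)/2} (sin t)/t dt`. -/
noncomputable def Ifun (d : ℕ) (x : ℝ) : ℝ :=
  (2 / π) * ∫ t in (0:ℝ)..(2 * π * x),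
    (1 - (t / (2 * π * x)) ^ 2) ^ (((d : ℝ) - 1) / 2) * (Real.sin t / t)

/-- On the period `[2πk, 2π(k+1)]`, with midpoint `m`, the product of `sinc` with an antitone
nonnegative weight `w` dominates `(w m / m) * sin`. -/
theorem antitone_mul_sinc_lower_bound {w : ℝ → ℝ} (hanti : AntitoneOn w (Set.Ici 0))
    (hnonneg : ∀ t, 0 ≤ w t) (k : ℕ) {t : ℝ} (h₁ : 2 * π * k ≤ t) (h₂ : t ≤ 2 * π * k + 2 * π) :
    w (2 * π * k + π) / (2 * π * k + π) * sin t ≤ w t * sinc t := by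
  have hπ := pi_pos
  have hk : 0 ≤ 2 * π * (k : ℝ) := by positivity
  have hsin : sin t = sin (t - 2 * π * k) := by
    rw [show 2 * π * (k : ℝ) = k * (2 * π) by ring, sin_sub_nat_mul_two_pi]
  rcases (hk.trans h₁).eq_or_lt with rfl | ht
  · simpa using hnonneg 0
  rw [sinc_of_ne_zero ht.ne', mul_div_left_comm, mul_comm]
  rcases le_total t (2 * π * k + π) with h | h
  · refine mul_le_mul_of_nonneg_left ?_ ?_
    · exact div_le_div₀ (hnonneg t) (hanti ht.le (ht.le.trans h) h) ht h
    · rw [hsin]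
      exact sin_nonneg_of_nonneg_of_le_pi (by linarith) (by linarith)
  · refine mul_le_mul_of_nonpos_left ?_ ?_
    · exact div_le_div₀ (hnonneg _) (hanti (by simp; linarith) ht.le h) (by linarith) h
    · rw [hsin, ← sin_sub_two_pi]
      exact sin_nonpos_of_nonpos_of_neg_pi_le (by linarith) (by linarith)

/-- The integral over `[0, a]` of `sinc` against an antitone nonnegative weight is nonnegative. -/
theorem integral_antitone_mul_sinc_nonneg {w : ℝ → ℝ} (hcont : Continuous w)
    (hanti : AntitoneOn w (Set.Ici 0)) (hnonneg : ∀ t, 0 ≤ w t) {a : ℝ} (ha : 0 ≤ a) :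
    0 ≤ ∫ t in (0 : ℝ)..a, w t * sinc t := by
  have hπ := pi_pos
  have hint : ∀ b c, IntervalIntegrable (fun t => w t * sinc t) volume b c :=
    fun b c => (hcont.mul continuous_sinc).intervalIntegrable b c
  have key : ∀ k : ℕ, ∀ b, 0 ≤ b → b ≤ 2 * π * k → 0 ≤ ∫ t in (0 : ℝ)..b, w t * sinc t := by
    intro k
    induction k with
    | zero =>
      intro b hb hb'
      obtain rfl : b = 0 := le_antisymm (by simpa using hb') hb
      simp
    | succ k ih =>
      intro b hb hb'
      rcases le_total b (2 * π * k) with h | h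
      · exact ih b hb h
      push_cast at hb'
      rw [← intervalIntegral.integral_add_adjacent_intervals (hint 0 (2 * π * k)) (hint _ b)]
      refine add_nonneg (ih _ (by positivity) le_rfl) ?_
      calc 0 ≤ w (2 * π * k + π) / (2 * π * k + π) * (1 - cos b) :=
            mul_nonneg (div_nonneg (hnonneg _) (by positivity)) (by linarith [cos_le_one b])
        _ = ∫ t in (2 * π * k)..b, w (2 * π * k + π) / (2 * π * k + π) * sin t := by
            rw [intervalIntegral.integral_const_mul, integral_sin,
              show 2 * π * (k : ℝ) = k * (2 * π) by ring, cos_nat_mul_two_pi]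
        _ ≤ ∫ t in (2 * π * k)..b, w t * sinc t :=
            intervalIntegral.integral_mono_on h
              ((continuous_const.mul continuous_sin).intervalIntegrable _ _) (hint _ _)
              fun t ht => antitone_mul_sinc_lower_bound hanti hnonneg k ht.1
                (ht.2.trans (by linarith))
  obtain ⟨k, hk⟩ := exists_nat_ge (a / (2 * π))
  exact key k a ha (by rwa [div_le_iff₀' (by positivity)] at hk)

/-- For every integer `d ≥ 1` and every real `x > 0`, `I(x) ≥ 0`. -/
theorem statement2 (d : ℕ) (hd : 1 ≤ d) (x : ℝ) (hx : 0 < x) :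
    0 ≤ Ifun d x := by
  have ha : 0 < 2 * π * x := by positivity
  have hp : 0 ≤ ((d : ℝ) - 1) / 2 := by
    have : (1 : ℝ) ≤ d := by exact_mod_cast hd
    linarith
  set a := 2 * π * x with ha_def
  have hmain := integral_antitone_mul_sinc_nonneg
    (w := fun t => max (1 - (t / a) ^ 2) 0 ^ (((d : ℝ) - 1) / 2))
    ((by fun_prop : Continuous fun t : ℝ => max (1 - (t / a) ^ 2) 0).rpow_const
      fun _ => Or.inr hp)
    (fun s hs t _ hst => by
      have hs' : 0 ≤ s := hs
      dsimp only
      gcongr)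
    (fun t => by positivity) ha.le
  unfold Ifun
  refine mul_nonneg (by positivity) (hmain.trans_eq ?_)
  rw [← ha_def]
  refine intervalIntegral.integral_congr_uIoo fun t ht => ?_
  rw [Set.uIoo_of_le ha.le] at ht
  have h : t / a ≤ 1 := (div_le_one ha).2 ht.2.le
  have h₀ : 0 ≤ t / a := div_nonneg ht.1.le ha.le
  rw [sinc_of_ne_zero ht.1.ne', max_eq_left (by nlinarith)]
end

section
/- For every integer d ≥ 1 and every real x > 0, I(x) ≤ (2/π) ∫₀^π (sin t)/t dt. -/
open MeasureTheory Real Filter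

/-- If `g` is nonnegative, continuous and antitone on `[π, T]` and differentiable inside, then
`∫ g(t) sin t dt` over `[π, T]` is nonpositive. -/
theorem integral_mul_sin_nonpos_of_antitoneOn {g : ℝ → ℝ} {T : ℝ} (hT : π ≤ T)
    (hcont : ContinuousOn g (Set.Icc π T)) (hanti : AntitoneOn g (Set.Icc π T))
    (hdiff : DifferentiableOn ℝ g (Set.Ioo π T)) (hnonneg : 0 ≤ g T) :
    ∫ t in π..T, g t * sin t ≤ 0 := by
  have hcont' : ContinuousOn (fun t => g t * sin t) (Set.Icc π T) :=
    hcont.mul Real.continuous_sin.continuousOn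
  have hint : IntervalIntegrable (fun t => g t * sin t) volume π T :=
    hcont'.intervalIntegrable_of_Icc hT
  have key : AntitoneOn (fun s => (∫ t in π..s, g t * sin t) + (1 + cos s) * g s)
      (Set.Icc π T) := by
    have hderiv : ∀ s ∈ Set.Ioo π T, HasDerivAt
        (fun s => (∫ t in π..s, g t * sin t) + (1 + cos s) * g s)
        ((1 + cos s) * deriv g s) s := by
      intro s hs
      have hnhds : Set.Icc π T ∈ nhds s := Icc_mem_nhds hs.1 hs.2
      have hg : HasDerivAt g (deriv g s) s :=
        (hdiff.differentiableAt (Ioo_mem_nhds hs.1 hs.2)).hasDerivAt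
      have hprim : HasDerivAt (fun s => ∫ t in π..s, g t * sin t) (g s * sin s) s := by
        refine intervalIntegral.integral_hasDerivAt_right ?_ ?_ (hcont'.continuousAt hnhds)
        · exact hint.mono_set (by
            rw [Set.uIcc_of_le hs.1.le, Set.uIcc_of_le hT]
            exact Set.Icc_subset_Icc_right hs.2.le)
        · exact (hcont'.mono Set.Ioo_subset_Icc_self).stronglyMeasurableAtFilter isOpen_Ioo s hs
      refine (hprim.add (((Real.hasDerivAt_cos s).const_add 1).mul hg)).congr_deriv ?_
      ring
    refine antitoneOn_of_deriv_nonpos (convex_Icc π T) ?_ ?_ ?_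
    · refine ContinuousOn.add ?_ ((by fun_prop : ContinuousOn _ _).mul hcont)
      have := intervalIntegral.continuousOn_primitive_interval'
        hint Set.left_mem_uIcc
      rwa [Set.uIcc_of_le hT] at this
    · rw [interior_Icc]
      exact fun s hs => (hderiv s hs).differentiableAt.differentiableWithinAt
    · rw [interior_Icc]
      intro s hs
      rw [(hderiv s hs).deriv]
      have hg' : deriv g s ≤ 0 := by
        rw [← derivWithin_of_mem_nhds (Icc_mem_nhds hs.1 hs.2)]
        exact hanti.derivWithin_nonpos
      exact mul_nonpos_of_nonneg_of_nonpos (by linarith [Real.neg_one_le_cos s]) hg'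
  have h := key (Set.left_mem_Icc.2 hT) (Set.right_mem_Icc.2 hT) hT
  simp only [intervalIntegral.integral_same, cos_pi] at h
  nlinarith [mul_nonneg (by linarith [Real.neg_one_le_cos T] : 0 ≤ 1 + cos T) hnonneg]

theorem intervalIntegrable_sin_div (a b : ℝ) :
    IntervalIntegrable (fun t => sin t / t) volume a b := by
  refine (Real.continuous_sinc.intervalIntegrable a b).congr_ae ?_
  refine ae_restrict_of_ae ?_
  filter_upwards [compl_mem_ae_iff.2 (measure_singleton (0 : ℝ))] with t ht
  exact sinc_of_ne_zero ht

theorem one_sub_div_sq_mem_Icc {T t : ℝ} (ht : t ∈ Set.Icc 0 T) :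
    1 - (t / T) ^ 2 ∈ Set.Icc (0 : ℝ) 1 := by
  have h₁ : t / T ≤ 1 := div_le_one_of_le₀ ht.2 (ht.1.trans ht.2)
  have h₀ : 0 ≤ t / T := div_nonneg ht.1 (ht.1.trans ht.2)
  constructor <;> nlinarith

theorem integral_one_sub_div_sq_rpow_mul_sin_div_le {p T : ℝ} (hp : 0 ≤ p) (hT : 0 < T) :
    ∫ t in (0 : ℝ)..T, (1 - (t / T) ^ 2) ^ p * (sin t / t) ≤
      ∫ t in (0 : ℝ)..π, sin t / t := by
  have hcont : Continuous fun t : ℝ => (1 - (t / T) ^ 2) ^ p :=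
    (by fun_prop : Continuous fun t : ℝ => 1 - (t / T) ^ 2).rpow_const fun _ => Or.inr hp
  have hint (a b : ℝ) : IntervalIntegrable
      (fun t => (1 - (t / T) ^ 2) ^ p * (sin t / t)) volume a b :=
    (intervalIntegrable_sin_div a b).continuousOn_mul hcont.continuousOn
  have hsin : ∀ t ∈ Set.Icc 0 π, 0 ≤ sin t / t := fun t ht =>
    div_nonneg (sin_nonneg_of_mem_Icc ht) ht.1
  have hle {b : ℝ} (hb : 0 ≤ b) (hbT : b ≤ T) (hbπ : b ≤ π) :
      ∫ t in (0 : ℝ)..b, (1 - (t / T) ^ 2) ^ p * (sin t / t) ≤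
        ∫ t in (0 : ℝ)..b, sin t / t := by
    refine intervalIntegral.integral_mono_on hb (hint 0 b) (intervalIntegrable_sin_div 0 b) ?_
    intro t ht
    have hmem := one_sub_div_sq_mem_Icc (T := T) ⟨ht.1, ht.2.trans hbT⟩
    exact mul_le_of_le_one_left (hsin t ⟨ht.1, ht.2.trans hbπ⟩)
      (Real.rpow_le_one hmem.1 hmem.2 hp)
  rcases le_total T π with hTπ | hπT
  · refine (hle hT.le le_rfl hTπ).trans ?_
    rw [← intervalIntegral.integral_add_adjacent_intervals (intervalIntegrable_sin_div 0 T)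
      (intervalIntegrable_sin_div T π)]
    have := intervalIntegral.integral_nonneg (μ := volume) hTπ
      (fun t ht => hsin t ⟨hT.le.trans ht.1, ht.2⟩)
    linarith
  · have htail : ∫ t in π..T, (1 - (t / T) ^ 2) ^ p * t⁻¹ * sin t ≤ 0 := by
      have hpos : ∀ t ∈ Set.Icc π T, 0 < t := fun t ht => Real.pi_pos.trans_le ht.1
      refine integral_mul_sin_nonpos_of_antitoneOn hπT ?_ ?_ ?_ ?_
      · exact hcont.continuousOn.mul (continuousOn_id.inv₀ fun t ht => (hpos t ht).ne')
      · intro a ha b hb hab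
        have ha₀ := hpos a ha
        have hb₀ := one_sub_div_sq_mem_Icc ⟨(hpos b hb).le, hb.2⟩
        have ha₁ := one_sub_div_sq_mem_Icc ⟨ha₀.le, ha.2⟩
        have := hb₀.1
        have := inv_nonneg.2 (hpos b hb).le
        have := Real.rpow_nonneg ha₁.1 p
        dsimp only
        gcongr
      · intro t ht
        have ht₀ := hpos t ⟨ht.1.le, ht.2.le⟩
        have hlt : t / T < 1 := (div_lt_one hT).2 ht.2
        have hne : 1 - (t / T) ^ 2 ≠ 0 := by
          have : 0 < t / T := div_pos ht₀ hT
          nlinarith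
        exact (((by fun_prop : DifferentiableAt ℝ (fun t : ℝ => 1 - (t / T) ^ 2) t).rpow_const
          (Or.inl hne)).mul (differentiableAt_inv ht₀.ne')).differentiableWithinAt
      · exact mul_nonneg (Real.rpow_nonneg (one_sub_div_sq_mem_Icc ⟨hT.le, le_rfl⟩).1 p)
          (inv_nonneg.2 hT.le)
    rw [← intervalIntegral.integral_add_adjacent_intervals (hint 0 π) (hint π T)]
    have heq : ∀ t : ℝ, (1 - (t / T) ^ 2) ^ p * (sin t / t) =
        (1 - (t / T) ^ 2) ^ p * t⁻¹ * sin t := fun t => by ring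
    simp only [← heq] at htail
    linarith [hle Real.pi_pos.le hπT le_rfl]

/-- For every integer `d ≥ 1` and every real `x > 0`, `I(x) ≤ (2/π) ∫₀^π (sin t)/t dt`. -/
theorem statement3 (d : ℕ) (hd : 1 ≤ d) (x : ℝ) (hx : 0 < x) :
    Ifun d x ≤ (2 / π) * ∫ t in (0:ℝ)..π, Real.sin t / t := by
  have hd' : (1 : ℝ) ≤ d := by exact_mod_cast hd
  exact mul_le_mul_of_nonneg_left
    (integral_one_sub_div_sq_rpow_mul_sin_div_le (by linarith) (by positivity)) (by positivity)
end

section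
/- Let d ≥ 1 be an integer, x > 0 a real number, and j ≥ 0 an integer. If (j+1)π ≤ 2πx then a_j(x) ≥ 0; and if moreover (j+2)π ≤ 2πx then a_{j+1}(x) ≤ a_j(x). -/
open MeasureTheory Real Filter

/-- `a_j(x) = ∫₀^π (1 − ((t + jπ)/(2πx))²)^{(d−1)/2} (sin t)/(t + jπ) dt`. -/
noncomputable def afun (d : ℕ) (x : ℝ) (j : ℕ) : ℝ :=
  ∫ t in (0:ℝ)..π,
    (1 - ((t + j * π) / (2 * π * x)) ^ 2) ^ (((d : ℝ) - 1) / 2) * (Real.sin t / (t + j * π))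

lemma one_sub_div_sq_nonneg {s c : ℝ} (hc : 0 < c) (hs : 0 ≤ s) (hsc : s ≤ c) :
    0 ≤ 1 - (s / c) ^ 2 :=
  sub_nonneg.2 (pow_le_one₀ (by positivity) ((div_le_one hc).2 hsc))

lemma add_natCast_mul_pi_le {j : ℕ} {c t : ℝ} (hj : ((j : ℝ) + 1) * π ≤ c) (ht : t ≤ π) :
    t + j * π ≤ c := by
  linarith

lemma afun_integrand_nonneg {d : ℕ} {x : ℝ} (hx : 0 < x) {j : ℕ}
    (hj : ((j : ℝ) + 1) * π ≤ 2 * π * x) {t : ℝ} (ht : 0 ≤ t) (htπ : t ≤ π) :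
    0 ≤ (1 - ((t + j * π) / (2 * π * x)) ^ 2) ^ (((d : ℝ) - 1) / 2) *
      (Real.sin t / (t + j * π)) :=
  mul_nonneg
    (rpow_nonneg (one_sub_div_sq_nonneg (by positivity) (by positivity)
      (add_natCast_mul_pi_le hj htπ)) _)
    (div_nonneg (sin_nonneg_of_nonneg_of_le_pi ht htπ) (by positivity))

lemma intervalIntegrable_afun_integrand {d : ℕ} (hd : 1 ≤ d) {x : ℝ} (hx : 0 < x) {j : ℕ}
    (hj : ((j : ℝ) + 1) * π ≤ 2 * π * x) :
    IntervalIntegrable (fun t : ℝ ↦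
      (1 - ((t + j * π) / (2 * π * x)) ^ 2) ^ (((d : ℝ) - 1) / 2) *
        (Real.sin t / (t + j * π))) volume 0 π := by
  have he : 0 ≤ ((d : ℝ) - 1) / 2 := by
    have : (1 : ℝ) ≤ d := by exact_mod_cast hd
    linarith
  rw [intervalIntegrable_iff_integrableOn_Ioc_of_le pi_pos.le]
  refine Measure.integrableOn_of_bounded (M := 1) (by simp)
    (Measurable.aestronglyMeasurable (by fun_prop)) ?_
  filter_upwards [ae_restrict_mem measurableSet_Ioc] with t ht
  rw [Real.norm_of_nonneg (afun_integrand_nonneg hx hj ht.1.le ht.2)]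
  have hjπ : 0 ≤ (j : ℝ) * π := by positivity
  have hs : 0 < t + j * π := by linarith [ht.1]
  refine mul_le_one₀ (rpow_le_one ?_ ?_ he)
    (div_nonneg (sin_nonneg_of_nonneg_of_le_pi ht.1.le ht.2) hs.le) ?_
  · exact one_sub_div_sq_nonneg (by positivity) hs.le (add_natCast_mul_pi_le hj ht.2)
  · exact sub_le_self _ (sq_nonneg _)
  · exact (div_le_one hs).2 (by linarith [sin_le ht.1.le])

/-- If `(j+1)π ≤ 2πx` then `a_j(x) ≥ 0`; if moreover `(j+2)π ≤ 2πx` then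
`a_{j+1}(x) ≤ a_j(x)`. -/
theorem statement4 (d : ℕ) (hd : 1 ≤ d) (x : ℝ) (hx : 0 < x) (j : ℕ)
    (hj : ((j : ℝ) + 1) * π ≤ 2 * π * x) :
    0 ≤ afun d x j ∧
    (((j : ℝ) + 2) * π ≤ 2 * π * x → afun d x (j + 1) ≤ afun d x j) := by
  refine ⟨intervalIntegral.integral_nonneg pi_pos.le
    fun t ht ↦ afun_integrand_nonneg hx hj ht.1 ht.2, fun hj2 ↦ ?_⟩
  have hj' : (((j + 1 : ℕ) : ℝ) + 1) * π ≤ 2 * π * x := by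
    push_cast
    linarith
  have he : 0 ≤ ((d : ℝ) - 1) / 2 := by
    have : (1 : ℝ) ≤ d := by exact_mod_cast hd
    linarith
  refine intervalIntegral.integral_mono_on_of_le_Ioo pi_pos.le
    (intervalIntegrable_afun_integrand hd hx hj') (intervalIntegrable_afun_integrand hd hx hj)
    fun t ht ↦ ?_
  have hs : 0 < t + j * π := add_pos_of_pos_of_nonneg ht.1 (by positivity)
  have hle : t + j * π ≤ t + (j + 1 : ℕ) * π := by
    push_cast
    linarith [pi_pos]
  have hbase := one_sub_div_sq_nonneg (by positivity : 0 < 2 * π * x) (hs.le.trans hle)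
    (add_natCast_mul_pi_le hj' ht.2.le)
  have hsin := sin_nonneg_of_nonneg_of_le_pi ht.1.le ht.2.le
  refine mul_le_mul (rpow_le_rpow hbase ?_ he) (div_le_div_of_nonneg_left hsin hs hle)
    (div_nonneg hsin (hs.le.trans hle)) (rpow_nonneg ?_ _)
  · gcongr
  · exact one_sub_div_sq_nonneg (by positivity) hs.le (add_natCast_mul_pi_le hj ht.2.le)
end

section
/- Let d ≥ 1 and k ≥ 1 be integers and let x be a real number with x ≥ k. Then the alternating sum satisfies 0 ≤ Σ_{j=0}^{2k−1} (−1)^j a_j(x) ≤ a_0(x). -/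
open MeasureTheory Real Filter Finset

/-- An alternating sum of an even number of antitone terms lies between `0` and the difference of
its first and last terms. -/
theorem alternating_sum_range_two_mul_bounds {f : ℕ → ℝ} {k : ℕ}
    (hf : ∀ j, j + 1 < 2 * k → f (j + 1) ≤ f j) (m : ℕ) (hm : m + 1 ≤ k) :
    0 ≤ ∑ j ∈ Finset.range (2 * (m + 1)), (-1 : ℝ) ^ j * f j ∧
    ∑ j ∈ Finset.range (2 * (m + 1)), (-1 : ℝ) ^ j * f j ≤ f 0 - f (2 * m + 1) := by
  induction m with
  | zero =>
    have := hf 0 (by lia)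
    simp only [zero_add] at this
    simp [Finset.sum_range_succ]
    linarith
  | succ m ih =>
    obtain ⟨h0, h1⟩ := ih (by lia)
    have h2 := hf (2 * m + 1) (by lia)
    have h3 := hf (2 * m + 2) (by lia)
    have hsum : ∑ j ∈ Finset.range (2 * (m + 1 + 1)), (-1 : ℝ) ^ j * f j =
        ∑ j ∈ Finset.range (2 * (m + 1)), (-1 : ℝ) ^ j * f j + f (2 * m + 2) - f (2 * m + 3) := by
      rw [show 2 * (m + 1 + 1) = 2 * (m + 1) + 1 + 1 by ring, Finset.sum_range_succ,
        Finset.sum_range_succ, pow_succ, pow_mul]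
      norm_num [show 2 * (m + 1) = 2 * m + 2 by ring]
      ring
    rw [hsum, show 2 * (m + 1) + 1 = 2 * m + 3 by ring]
    constructor <;> linarith

/-- The integrand of `afun`. -/
noncomputable def afunIntegrand (d : ℕ) (x : ℝ) (j : ℕ) (t : ℝ) : ℝ :=
  (1 - ((t + j * π) / (2 * π * x)) ^ 2) ^ (((d : ℝ) - 1) / 2) * (Real.sin t / (t + j * π))

theorem one_sub_sq_nonneg_of_shift_le {x t : ℝ} {j : ℕ} (hx : 0 < x) (hj : (j : ℝ) + 1 ≤ 2 * x)
    (ht : t ∈ Set.Ioc 0 π) : 0 ≤ 1 - ((t + j * π) / (2 * π * x)) ^ 2 := by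
  have hπ := Real.pi_pos
  have ht0 : 0 < t := ht.1
  have h1 : (t + j * π) / (2 * π * x) ≤ 1 := by
    rw [div_le_one (by positivity)]
    nlinarith [ht.2]
  have h0 : 0 ≤ (t + j * π) / (2 * π * x) := by positivity
  nlinarith

theorem sin_nonneg_of_mem_Ioc {t : ℝ} (ht : t ∈ Set.Ioc 0 π) : 0 ≤ Real.sin t :=
  Real.sin_nonneg_of_nonneg_of_le_pi ht.1.le ht.2

theorem afunIntegrand_nonneg (d : ℕ) {x t : ℝ} {j : ℕ} (hx : 0 < x) (hj : (j : ℝ) + 1 ≤ 2 * x)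
    (ht : t ∈ Set.Ioc 0 π) : 0 ≤ afunIntegrand d x j t := by
  have ht0 : 0 < t := ht.1
  have hs := sin_nonneg_of_mem_Ioc ht
  exact mul_nonneg (Real.rpow_nonneg (one_sub_sq_nonneg_of_shift_le hx hj ht) _) (by positivity)

theorem afunIntegrand_le_one {d : ℕ} (hd : 1 ≤ d) {x t : ℝ} {j : ℕ} (hx : 0 < x)
    (hj : (j : ℝ) + 1 ≤ 2 * x) (ht : t ∈ Set.Ioc 0 π) : afunIntegrand d x j t ≤ 1 := by
  have hd' : (1 : ℝ) ≤ d := by exact_mod_cast hd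
  have ht0 : 0 < t := ht.1
  have hs := sin_nonneg_of_mem_Ioc ht
  refine mul_le_one₀ ?_ (by positivity) ?_
  · exact Real.rpow_le_one (one_sub_sq_nonneg_of_shift_le hx hj ht)
      (sub_le_self _ (sq_nonneg _)) (by linarith)
  · rw [div_le_one (by positivity)]
    have : (0 : ℝ) ≤ j * π := by positivity
    linarith [Real.sin_le ht0.le]

theorem afunIntegrand_succ_le {d : ℕ} (hd : 1 ≤ d) {x t : ℝ} {j : ℕ} (hx : 0 < x)
    (hj : (j : ℝ) + 2 ≤ 2 * x) (ht : t ∈ Set.Ioc 0 π) :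
    afunIntegrand d x (j + 1) t ≤ afunIntegrand d x j t := by
  have hd' : (1 : ℝ) ≤ d := by exact_mod_cast hd
  have ht0 : 0 < t := ht.1
  have hs := sin_nonneg_of_mem_Ioc ht
  have hle : t + j * π ≤ t + (j + 1 : ℕ) * π := by
    push_cast
    linarith [Real.pi_pos]
  have hbase := one_sub_sq_nonneg_of_shift_le (j := j + 1) hx (by push_cast; linarith) ht
  unfold afunIntegrand
  gcongr
  exact Real.rpow_nonneg (one_sub_sq_nonneg_of_shift_le hx (by linarith) ht) _

theorem intervalIntegrable_afunIntegrand {d : ℕ} (hd : 1 ≤ d) {x : ℝ} {j : ℕ} (hx : 0 < x)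
    (hj : (j : ℝ) + 1 ≤ 2 * x) :
    IntervalIntegrable (afunIntegrand d x j) volume 0 π := by
  refine (intervalIntegrable_const (c := (1 : ℝ))).mono_fun' ?_ ?_
  · unfold afunIntegrand
    exact Measurable.aestronglyMeasurable (by fun_prop)
  · rw [Set.uIoc_of_le Real.pi_pos.le]
    filter_upwards [ae_restrict_mem measurableSet_Ioc] with t ht
    rw [Real.norm_of_nonneg (afunIntegrand_nonneg d hx hj ht)]
    exact afunIntegrand_le_one hd hx hj ht

theorem afun_nonneg (d : ℕ) {x : ℝ} {j : ℕ} (hx : 0 < x) (hj : (j : ℝ) + 1 ≤ 2 * x) :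
    0 ≤ afun d x j := by
  rw [afun, intervalIntegral.integral_of_le Real.pi_pos.le]
  exact setIntegral_nonneg measurableSet_Ioc fun t ht => afunIntegrand_nonneg d hx hj ht

theorem afun_succ_le {d : ℕ} (hd : 1 ≤ d) {x : ℝ} {j : ℕ} (hx : 0 < x)
    (hj : (j : ℝ) + 2 ≤ 2 * x) : afun d x (j + 1) ≤ afun d x j := by
  refine intervalIntegral.integral_mono_on_of_le_Ioo Real.pi_pos.le
    (intervalIntegrable_afunIntegrand hd hx (by push_cast; linarith))
    (intervalIntegrable_afunIntegrand hd hx (by linarith)) fun t ht => ?_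
  exact afunIntegrand_succ_le hd hx hj (Set.Ioo_subset_Ioc_self ht)

/-- For integers `d ≥ 1`, `k ≥ 1` and real `x ≥ k`,
`0 ≤ Σ_{j=0}^{2k−1} (−1)^j a_j(x) ≤ a_0(x)`. -/
theorem statement5 (d k : ℕ) (hd : 1 ≤ d) (hk : 1 ≤ k) (x : ℝ) (hx : (k : ℝ) ≤ x) :
    0 ≤ ∑ j ∈ Finset.range (2 * k), (-1 : ℝ) ^ j * afun d x j ∧
    ∑ j ∈ Finset.range (2 * k), (-1 : ℝ) ^ j * afun d x j ≤ afun d x 0 := by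
  have hk' : (1 : ℝ) ≤ k := by exact_mod_cast hk
  have hx0 : 0 < x := by linarith
  obtain ⟨m, rfl⟩ : ∃ m, k = m + 1 := ⟨k - 1, by lia⟩
  have hanti : ∀ j, j + 1 < 2 * (m + 1) → afun d x (j + 1) ≤ afun d x j := fun j hj => by
    have : (j : ℝ) + 2 ≤ 2 * (m + 1 : ℕ) := by exact_mod_cast hj
    exact afun_succ_le hd hx0 (by linarith)
  obtain ⟨h0, h1⟩ := alternating_sum_range_two_mul_bounds hanti m le_rfl
  have hlast : 0 ≤ afun d x (2 * m + 1) :=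
    afun_nonneg d hx0 (by push_cast at hx ⊢; linarith)
  exact ⟨h0, by linarith⟩
end

section
/- Let d ≥ 1 be an integer and x > 0 a real number, and define φ(t) = (2/π)(1 − (t/(2πx))²)^{(d−1)/2} (sin t)/t for 0 < t ≤ 2πx. Then for every t with 0 < t and t + π ≤ 2πx, one has |φ(π + t)| ≤ |φ(t)|. -/
open MeasureTheory Real Filter

/-- Let `φ(t) = (2/π)(1 − (t/(2πx))²)^{(d−1)/2} (sin t)/t`. Then for every `t > 0` with
`t + π ≤ 2πx`, one has `|φ(π + t)| ≤ |φ(t)|`. -/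
theorem statement6 (d : ℕ) (hd : 1 ≤ d) (x : ℝ) (hx : 0 < x) (φ : ℝ → ℝ)
    (hφ : ∀ t : ℝ,
      φ t = (2 / π) * (1 - (t / (2 * π * x)) ^ 2) ^ (((d : ℝ) - 1) / 2) * (Real.sin t / t))
    (t : ℝ) (ht : 0 < t) (ht' : t + π ≤ 2 * π * x) :
    |φ (π + t)| ≤ |φ t| := by
  have hπ := Real.pi_pos
  have hR : 0 < 2 * π * x := by positivity
  have hd' : (1 : ℝ) ≤ d := by exact_mod_cast hd
  have hle : t / (2 * π * x) ≤ (π + t) / (2 * π * x) := by gcongr; linarith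
  have hle_one : (π + t) / (2 * π * x) ≤ 1 := (div_le_one hR).2 (by linarith)
  have hnonneg : 0 ≤ t / (2 * π * x) := by positivity
  have hbase : 0 ≤ 1 - ((π + t) / (2 * π * x)) ^ 2 := by nlinarith
  have hbase' : 1 - ((π + t) / (2 * π * x)) ^ 2 ≤ 1 - (t / (2 * π * x)) ^ 2 := by nlinarith
  have hsin : Real.sin (π + t) = -Real.sin t := by rw [add_comm, Real.sin_add_pi]
  have hpow := Real.rpow_le_rpow hbase hbase' (show 0 ≤ ((d : ℝ) - 1) / 2 by linarith)
  have hpow_nonneg := Real.rpow_nonneg hbase (((d : ℝ) - 1) / 2)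
  have hpow_nonneg' := hpow_nonneg.trans hpow
  rw [hφ, hφ, hsin]
  simp only [abs_mul, abs_div, abs_neg]
  rw [abs_of_nonneg hpow_nonneg, abs_of_nonneg hpow_nonneg',
    abs_of_pos ht, abs_of_pos (show 0 < π + t by linarith)]
  gcongr
  linarith
end

section
/- For every integer d ≥ 1 and every t > 0, the function φ_t is nonnegative, integrable on ℝ^d, and ∫_{ℝ^d} φ_t(x) dx = 1; in particular ‖φ_t‖_{L¹(ℝ^d)} = 1. -/
open MeasureTheory Real Filter

/-- The Pochhammer symbol `(q)_n = q (q+1) ⋯ (q+n−1)`. -/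
noncomputable def poch (q : ℝ) (n : ℕ) : ℝ := ∏ i ∈ Finset.range n, (q + i)

/-- The Gauss hypergeometric series `₂F₁(1/2, (1+d)/2; (2+d)/2; z)`. -/
noncomputable def Fhyp (d : ℕ) (z : ℝ) : ℝ :=
  ∑' n : ℕ, (poch (1 / 2) n * poch ((1 + (d : ℝ)) / 2) n / poch ((2 + (d : ℝ)) / 2) n) *
    z ^ n / n.factorial

/-- The kernel `φ_t` on `ℝ^d`. -/
noncomputable def phifun (d : ℕ) (t : ℝ) (x : EuclideanSpace ℝ (Fin d)) : ℝ :=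
  if t < ‖x‖ then
    Real.Gamma ((1 + (d : ℝ)) / 2) ^ 2 * t /
        (π ^ (1 + (d : ℝ) / 2) * Real.Gamma (1 + (d : ℝ) / 2) * ‖x‖ ^ (1 + (d : ℝ))) *
      Fhyp d (t ^ 2 / ‖x‖ ^ 2)
  else if ‖x‖ < t then
    Real.Gamma ((1 + (d : ℝ)) / 2) ^ 2 * t ^ (-(d : ℝ)) /
        (π ^ (1 + (d : ℝ) / 2) * Real.Gamma (1 + (d : ℝ) / 2)) *
      Fhyp d (‖x‖ ^ 2 / t ^ 2)
  else 0

lemma poch_succ (q : ℝ) (n : ℕ) : poch q (n + 1) = poch q n * (q + n) := by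
  simp [poch, Finset.prod_range_succ]

lemma poch_pos {q : ℝ} (hq : 0 < q) (n : ℕ) : 0 < poch q n :=
  Finset.prod_pos fun _ _ => by positivity

lemma ascPochhammer_eval_eq_poch (q : ℝ) (n : ℕ) : (ascPochhammer ℝ n).eval q = poch q n := by
  induction n with
  | zero => simp [poch]
  | succ n ih => rw [ascPochhammer_succ_eval, ih, poch_succ]

lemma choose_eq_poch_div_factorial (q : ℝ) (n : ℕ) :
    Ring.choose (q + n - 1) n = poch q n / n.factorial := by
  have h := Ring.factorial_nsmul_multichoose_eq_ascPochhammer q n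
  rw [Polynomial.ascPochhammer_smeval_eq_eval, ascPochhammer_eval_eq_poch, nsmul_eq_mul,
    Ring.multichoose_eq] at h
  rw [← h, mul_div_cancel_left₀ _ (by positivity)]

lemma Gamma_add_nat_eq_poch_mul {q : ℝ} (hq : 0 < q) (n : ℕ) :
    Gamma (q + n) = poch q n * Gamma q := by
  induction n with
  | zero => simp [poch]
  | succ n ih =>
    rw [Nat.cast_succ, ← add_assoc, Gamma_add_one (by positivity), ih, poch_succ]
    ring

/-- The binomial series of `(1 - u) ^ (-q)`. -/
lemma hasSum_poch_mul_pow (q : ℝ) {u : ℝ} (hu : |u| < 1) :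
    HasSum (fun n : ℕ => poch q n / n.factorial * u ^ n) ((1 - u) ^ (-q)) := by
  have hu1 : u ∈ Metric.eball (0 : ℝ) 1 := by
    rw [← ENNReal.ofReal_one, Metric.eball_ofReal]
    simpa using hu
  have h := (one_div_one_sub_rpow_hasFPowerSeriesOnBall_zero q).hasSum hu1
  have h0 : 0 ≤ 1 - u := by linarith [(abs_lt.1 hu).2]
  rw [zero_add, one_div, ← rpow_neg h0] at h
  convert! h using 2 with n
  rw [FormalMultilinearSeries.ofScalars_apply_eq, choose_eq_poch_div_factorial, smul_eq_mul]

/-- The coefficients of the binomial series of `(1 - u) ^ (-1/2)`. -/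
noncomputable def halfCoeff (n : ℕ) : ℝ := poch (1 / 2) n / n.factorial

lemma halfCoeff_pos (n : ℕ) : 0 < halfCoeff n :=
  div_pos (poch_pos (by norm_num) n) (by positivity)

lemma integral_Ioo_rpow {t a : ℝ} (ht : 0 < t) (ha : 0 < a) :
    ∫ u in Set.Ioo 0 t, u ^ (a - 1) = t ^ a / a := by
  rw [← integral_Ioc_eq_integral_Ioo, ← intervalIntegral.integral_of_le ht.le,
    integral_rpow (Or.inl (by linarith)), sub_add_cancel, zero_rpow ha.ne', sub_zero]

lemma integrableOn_Ioo_rpow {t a : ℝ} (ht : 0 < t) (ha : 0 < a) :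
    IntegrableOn (fun u : ℝ => u ^ (a - 1)) (Set.Ioo 0 t) :=
  Integrable.of_integral_ne_zero (by rw [integral_Ioo_rpow ht ha]; positivity)

/-- Termwise integration of the binomial series in the Beta integral. -/
lemma hasSum_halfCoeff_div {x : ℝ} (hx : 0 < x) :
    HasSum (fun m : ℕ => halfCoeff m / (2 * m + x))
      (Gamma (x / 2) * √π / Gamma (x / 2 + 1 / 2) / 2) := by
  set B := ProbabilityTheory.beta (x / 2) (1 / 2) with hB
  have hBpos : 0 < B := ProbabilityTheory.beta_pos (by positivity) (by norm_num)
  have h1 := ProbabilityTheory.lintegral_betaPDF_eq_one (α := x / 2) (β := 1 / 2)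
    (by positivity) (by norm_num)
  rw [ProbabilityTheory.lintegral_betaPDF] at h1
  set c : ℕ → ℝ := fun m => halfCoeff m / (m + x / 2) / B with hc
  have hcpos : ∀ m, 0 ≤ c m := fun m => by
    have := (halfCoeff_pos m).le
    positivity
  have h2 : ∑' m : ℕ, ENNReal.ofReal (c m) = 1 := by
    rw [← h1]
    have hterm : ∀ m : ℕ, ENNReal.ofReal (c m) =
        ∫⁻ u in Set.Ioo (0 : ℝ) 1,
          ENNReal.ofReal (halfCoeff m / B * u ^ ((m + x / 2) - 1)) := by
      intro m
      have hm : (0 : ℝ) < m + x / 2 := by positivity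
      have := halfCoeff_pos m
      rw [← ofReal_integral_eq_lintegral_ofReal
        ((integrableOn_Ioo_rpow one_pos hm).const_mul _), integral_const_mul,
        integral_Ioo_rpow one_pos hm, one_rpow]
      · congr 1
        simp only [hc]
        ring
      · refine (ae_restrict_iff' measurableSet_Ioo).2 (Filter.Eventually.of_forall ?_)
        intro u hu
        have := hu.1
        simp only [Pi.zero_apply]
        positivity
    simp_rw [hterm]
    rw [← lintegral_tsum (fun m => by fun_prop)]
    refine setLIntegral_congr_fun measurableSet_Ioo fun u hu => ?_
    have hs := hasSum_poch_mul_pow (1 / 2) (u := u) (abs_lt.2 ⟨by linarith [hu.1], hu.2⟩)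
    have hs2 := hs.mul_left (1 / B * u ^ (x / 2 - 1))
    have he : (fun m : ℕ => 1 / B * u ^ (x / 2 - 1) * (poch (1 / 2) m / m.factorial * u ^ m)) =
        fun m : ℕ => halfCoeff m / B * u ^ ((m + x / 2) - 1) := by
      funext m
      rw [add_sub_assoc, rpow_add hu.1, rpow_natCast, halfCoeff]
      ring
    rw [he] at hs2
    have hu1 := hu.1
    rw [show (1 / 2 - 1 : ℝ) = -(1 / 2) by norm_num, ← hs2.tsum_eq,
      ENNReal.ofReal_tsum_of_nonneg _ hs2.summable]
    intro m
    have := halfCoeff_pos m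
    positivity
  have hsum : HasSum c 1 := by
    have hs := ENNReal.summable_toReal (h2.trans_ne ENNReal.one_ne_top)
    simp_rw [ENNReal.toReal_ofReal (hcpos _)] at hs
    rw [← ENNReal.ofReal_tsum_of_nonneg hcpos hs, ENNReal.ofReal_eq_one] at h2
    exact h2 ▸ hs.hasSum
  convert! hsum.mul_left (B / 2) using 1
  · funext m
    have hm : (0 : ℝ) < m + x / 2 := by positivity
    simp only [hc]
    field_simp
  · rw [hB, ProbabilityTheory.beta, Gamma_one_half_eq]
    ring

/-- Symmetrisation of a product of two series, using
`1 / ((2n+1)(2m+x)) = (1 / (2n+1) + 1 / (2m+x)) / (2m+2n+x+1)`. -/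
lemma tsum_halfCoeff_symm {x : ℝ} (hx : 0 < x) {g : ℝ → ℝ}
    (hg : ∀ y, 0 < y → HasSum (fun m : ℕ => halfCoeff m / (2 * m + y)) (g y)) :
    Summable (fun n : ℕ => halfCoeff n * g (2 * n + x + 1) / (2 * n + 1)) ∧
    Summable (fun n : ℕ => halfCoeff n * g (2 * n + x + 1) / (2 * n + x)) ∧
    ∑' n : ℕ, halfCoeff n * g (2 * n + x + 1) / (2 * n + 1) +
      ∑' n : ℕ, halfCoeff n * g (2 * n + x + 1) / (2 * n + x) = g x * g 1 := by
  have hp := halfCoeff_pos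
  set f : ℕ × ℕ → ℝ := fun p =>
    halfCoeff p.1 / (2 * p.1 + x) * (halfCoeff p.2 / (2 * p.2 + 1)) with hf
  set f1 : ℕ × ℕ → ℝ := fun p =>
    halfCoeff p.1 * halfCoeff p.2 / ((2 * p.1 + 2 * p.2 + x + 1) * (2 * p.2 + 1)) with hf1
  set f2 : ℕ × ℕ → ℝ := fun p =>
    halfCoeff p.1 * halfCoeff p.2 / ((2 * p.1 + 2 * p.2 + x + 1) * (2 * p.1 + x)) with hf2
  have hadd : ∀ p, f1 p + f2 p = f p := by
    intro p
    simp only [hf, hf1, hf2]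
    field_simp
    ring
  have h1pos : ∀ p, 0 ≤ f1 p := fun p => by
    have := hp p.1; have := hp p.2
    simp only [hf1]; positivity
  have h2pos : ∀ p, 0 ≤ f2 p := fun p => by
    have := hp p.1; have := hp p.2
    simp only [hf2]; positivity
  have hx1 := hg x hx
  have h11 := hg 1 one_pos
  have hfs : Summable f := hx1.summable.mul_of_nonneg h11.summable
    (fun m => by have := hp m; simp only [Pi.zero_apply]; positivity)
    (fun m => by have := hp m; simp only [Pi.zero_apply]; positivity)
  have hfsum : HasSum f (g x * g 1) := hx1.mul h11 hfs
  have h1s : Summable f1 := hfs.of_nonneg_of_le h1pos fun p => by linarith [hadd p, h2pos p]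
  have h2s : Summable f2 := hfs.of_nonneg_of_le h2pos fun p => by linarith [hadd p, h1pos p]
  have hs1 : HasSum (fun n : ℕ => halfCoeff n * g (2 * n + x + 1) / (2 * n + 1)) (∑' p, f1 p) := by
    refine ((Equiv.prodComm ℕ ℕ).hasSum_iff.2 h1s.hasSum).prod_fiberwise fun n => ?_
    convert! (hg (2 * n + x + 1) (by positivity)).mul_left (halfCoeff n / (2 * n + 1)) using 1
    · funext m
      simp only [hf1, Function.comp_apply, Equiv.prodComm_apply, Prod.swap_prod_mk]
      field_simp
      ring
    · ring
  have hs2 : HasSum (fun n : ℕ => halfCoeff n * g (2 * n + x + 1) / (2 * n + x)) (∑' p, f2 p) := by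
    refine h2s.hasSum.prod_fiberwise fun n => ?_
    convert! (hg (2 * n + x + 1) (by positivity)).mul_left (halfCoeff n / (2 * n + x)) using 1
    · funext m
      simp only [hf2]
      field_simp
      ring
    · ring
  refine ⟨hs1.summable, hs2.summable, ?_⟩
  rw [hs1.tsum_eq, hs2.tsum_eq, ← h1s.tsum_add h2s, ← hfsum.tsum_eq]
  exact tsum_congr hadd

/-- The coefficients of `Fhyp d`. -/
noncomputable def hypCoeff (d n : ℕ) : ℝ :=
  poch (1 / 2) n * poch ((1 + (d : ℝ)) / 2) n / poch ((2 + (d : ℝ)) / 2) n / n.factorial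

lemma hypCoeff_pos (d n : ℕ) : 0 < hypCoeff d n :=
  div_pos (div_pos (mul_pos (poch_pos (by norm_num) n) (poch_pos (by positivity) n))
    (poch_pos (by positivity) n)) (by positivity)

lemma Fhyp_eq_tsum (d : ℕ) (z : ℝ) : Fhyp d z = ∑' n : ℕ, hypCoeff d n * z ^ n :=
  tsum_congr fun n => by rw [hypCoeff]; ring

lemma Fhyp_nonneg (d : ℕ) {z : ℝ} (hz : 0 ≤ z) : 0 ≤ Fhyp d z := by
  rw [Fhyp_eq_tsum]
  exact tsum_nonneg fun n => mul_nonneg (hypCoeff_pos d n).le (pow_nonneg hz n)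

lemma tsum_hypCoeff {d : ℕ} (hd : 1 ≤ d) :
    Summable (fun n : ℕ => hypCoeff d n / (2 * n + 1)) ∧
    Summable (fun n : ℕ => hypCoeff d n / (2 * n + d)) ∧
    ∑' n : ℕ, hypCoeff d n / (2 * n + 1) + ∑' n : ℕ, hypCoeff d n / (2 * n + d) =
      π / 2 * Gamma ((d : ℝ) / 2) * Gamma (1 + (d : ℝ) / 2) / Gamma ((1 + (d : ℝ)) / 2) ^ 2 := by
  have hd0 : (0 : ℝ) < d := by exact_mod_cast hd
  set G1 := Gamma ((1 + (d : ℝ)) / 2) with hG1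
  set G2 := Gamma (1 + (d : ℝ) / 2) with hG2
  have hG1pos : 0 < G1 := Gamma_pos_of_pos (by positivity)
  have hG2pos : 0 < G2 := Gamma_pos_of_pos (by positivity)
  have hpi : 0 < √π := sqrt_pos.2 pi_pos
  obtain ⟨h1, h2, h3⟩ := tsum_halfCoeff_symm hd0 (fun y hy => hasSum_halfCoeff_div hy)
  set K := G1 * √π / G2 / 2 with hK
  have hKpos : 0 < K := by positivity
  have key : ∀ n : ℕ, halfCoeff n * (Gamma ((2 * n + d + 1) / 2) * √π /
      Gamma ((2 * n + d + 1) / 2 + 1 / 2) / 2) = K * hypCoeff d n := by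
    intro n
    have e1 : (2 * n + d + 1 : ℝ) / 2 = (1 + d) / 2 + n := by ring
    have e2 : (2 * n + d + 1 : ℝ) / 2 + 1 / 2 = (2 + d) / 2 + n := by ring
    have e3 : (2 + d : ℝ) / 2 = 1 + d / 2 := by ring
    rw [e2, e1, Gamma_add_nat_eq_poch_mul (by positivity), Gamma_add_nat_eq_poch_mul (by positivity),
      hypCoeff, halfCoeff, e3, ← hG1, ← hG2, hK]
    have := poch_pos (q := 1 + (d : ℝ) / 2) (by positivity) n
    field_simp
  simp_rw [key, mul_div_assoc] at h1 h2 h3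
  rw [tsum_mul_left, tsum_mul_left, ← mul_add] at h3
  refine ⟨(summable_mul_left_iff hKpos.ne').1 h1, (summable_mul_left_iff hKpos.ne').1 h2, ?_⟩
  refine mul_left_cancel₀ hKpos.ne' (h3.trans ?_)
  rw [show (d : ℝ) / 2 + 1 / 2 = (1 + d) / 2 by ring, ← hG1, Gamma_one_half_eq,
    show (1 / 2 + 1 / 2 : ℝ) = 1 by norm_num, Gamma_one, hK]
  field_simp
  rw [sq_sqrt pi_pos.le]

lemma setIntegral_tsum_of_nonneg {s : Set ℝ} (hs : MeasurableSet s) {c I : ℕ → ℝ}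
    {g : ℕ → ℝ → ℝ} (hc : ∀ n, 0 ≤ c n) (hg : ∀ n, ∀ r ∈ s, 0 ≤ g n r)
    (hgi : ∀ n, IntegrableOn (g n) s) (hI : ∀ n, ∫ r in s, g n r = I n)
    (hsum : Summable fun n => c n * I n) :
    ∫ r in s, ∑' n, c n * g n r = ∑' n, c n * I n := by
  have hnorm : ∀ n, ∫ r in s, ‖c n * g n r‖ = c n * I n := by
    intro n
    rw [← hI n, ← integral_const_mul]
    exact setIntegral_congr_fun hs fun r hr =>
      norm_of_nonneg (mul_nonneg (hc n) (hg n r hr))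
  have h := hasSum_integral_of_summable_integral_norm (F := fun n r => c n * g n r)
    (μ := volume.restrict s) (fun n => (hgi n).const_mul _) (by simpa only [hnorm] using hsum)
  rw [← h.tsum_eq]
  exact tsum_congr fun n => by rw [integral_const_mul, hI]

/-- The normalising constant of `phifun d t`. -/
noncomputable def phiConst (d : ℕ) : ℝ :=
  Gamma ((1 + (d : ℝ)) / 2) ^ 2 / (π ^ (1 + (d : ℝ) / 2) * Gamma (1 + (d : ℝ) / 2))

lemma phiConst_pos (d : ℕ) : 0 < phiConst d := by
  have := Gamma_pos_of_pos (s := (1 + (d : ℝ)) / 2) (by positivity)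
  have := Gamma_pos_of_pos (s := 1 + (d : ℝ) / 2) (by positivity)
  have := pi_pos
  unfold phiConst
  positivity

/-- The radial profile of `phifun d t`. -/
noncomputable def phiProfile (d : ℕ) (t r : ℝ) : ℝ :=
  if t < r then phiConst d * (t / r ^ (1 + d)) * Fhyp d (t ^ 2 / r ^ 2)
  else if r < t then phiConst d * (1 / t ^ d) * Fhyp d (r ^ 2 / t ^ 2)
  else 0

lemma phifun_eq_phiProfile (d : ℕ) {t : ℝ} (ht : 0 < t) (x : EuclideanSpace ℝ (Fin d)) :
    phifun d t x = phiProfile d t ‖x‖ := by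
  have e : (1 + (d : ℝ)) = ((1 + d : ℕ) : ℝ) := by push_cast; rfl
  have h1 : ‖x‖ ^ (1 + (d : ℝ)) = ‖x‖ ^ (1 + d) := by rw [e, rpow_natCast]
  have h2 : t ^ (-(d : ℝ)) = 1 / t ^ d := by rw [rpow_neg ht.le, rpow_natCast, one_div]
  unfold phifun phiProfile phiConst
  rw [h1, h2]
  congr 2
  · rw [div_mul_div_comm]
  · congr 1
    ring

lemma phiProfile_nonneg (d : ℕ) {t r : ℝ} (ht : 0 < t) (hr : 0 ≤ r) : 0 ≤ phiProfile d t r := by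
  have hC := phiConst_pos d
  unfold phiProfile
  split_ifs
  · have := Fhyp_nonneg d (z := t ^ 2 / r ^ 2) (by positivity)
    positivity
  · have := Fhyp_nonneg d (z := r ^ 2 / t ^ 2) (by positivity)
    positivity
  · exact le_rfl

lemma integral_phiProfile_inner {d : ℕ} (hd : 1 ≤ d) {t : ℝ} (ht : 0 < t) :
    ∫ r in Set.Ioo 0 t, r ^ (d - 1) * phiProfile d t r =
      phiConst d * ∑' n : ℕ, hypCoeff d n / (2 * n + d) := by
  have hd0 : (0 : ℝ) < d := by exact_mod_cast hd
  have hC := phiConst_pos d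
  have hval : ∀ n : ℕ, phiConst d * hypCoeff d n / t ^ (2 * n + d : ℝ) *
      (t ^ (2 * n + d : ℝ) / (2 * n + d)) = phiConst d * (hypCoeff d n / (2 * n + d)) := by
    intro n
    have : 0 < t ^ (2 * n + d : ℝ) := rpow_pos_of_pos ht _
    field_simp
  rw [← tsum_mul_left, ← tsum_congr hval, ← setIntegral_tsum_of_nonneg measurableSet_Ioo
    (g := fun n r => r ^ ((2 * n + d : ℝ) - 1))]
  · refine setIntegral_congr_fun measurableSet_Ioo fun r hr => ?_
    have hr0 := hr.1
    simp only [phiProfile]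
    rw [if_neg hr.2.not_gt, if_pos hr.2, Fhyp_eq_tsum, ← tsum_mul_left, ← tsum_mul_left]
    refine tsum_congr fun n => ?_
    have e1 : t ^ (2 * n + d : ℝ) = t ^ (2 * n + d) := by
      rw [← rpow_natCast]; push_cast; rfl
    have e2 : r ^ ((2 * n + d : ℝ) - 1) = r ^ (2 * n) * r ^ (d - 1) := by
      rw [← pow_add, ← rpow_natCast]
      push_cast [Nat.cast_sub hd]
      ring_nf
    rw [e1, e2, div_pow, ← pow_mul, ← pow_mul, pow_add]
    field_simp
  · intro n
    have := hypCoeff_pos d n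
    positivity
  · intro n r hr
    exact rpow_nonneg hr.1.le _
  · exact fun n => integrableOn_Ioo_rpow ht (by positivity)
  · exact fun n => integral_Ioo_rpow ht (by positivity)
  · simp_rw [hval]
    exact (tsum_hypCoeff hd).2.1.mul_left _

lemma integral_phiProfile_outer {d : ℕ} (hd : 1 ≤ d) {t : ℝ} (ht : 0 < t) :
    ∫ r in Set.Ioi t, r ^ (d - 1) * phiProfile d t r =
      phiConst d * ∑' n : ℕ, hypCoeff d n / (2 * n + 1) := by
  have hC := phiConst_pos d
  have hval : ∀ n : ℕ, phiConst d * hypCoeff d n * t ^ (2 * n + 1) *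
      (1 / t ^ (2 * n + 1) / (2 * n + 1)) = phiConst d * (hypCoeff d n / (2 * n + 1)) := by
    intro n
    field_simp
  rw [← tsum_mul_left, ← tsum_congr hval, ← setIntegral_tsum_of_nonneg measurableSet_Ioi
    (g := fun n r => r ^ (-(2 * n + 2) : ℝ))]
  · refine setIntegral_congr_fun measurableSet_Ioi fun r hr => ?_
    have hr0 : 0 < r := ht.trans hr
    simp only [phiProfile]
    rw [if_pos (Set.mem_Ioi.1 hr), Fhyp_eq_tsum, ← tsum_mul_left, ← tsum_mul_left]
    refine tsum_congr fun n => ?_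
    have e2 : r ^ (-(2 * n + 2) : ℝ) = 1 / r ^ (2 * n + 2) := by
      rw [rpow_neg hr0.le, ← rpow_natCast, one_div]; push_cast; rfl
    have e3 : r ^ (1 + d) = r ^ 2 * r ^ (d - 1) := by
      rw [← pow_add]; congr 1; omega
    rw [e2, e3, div_pow, ← pow_mul, ← pow_mul, pow_add, pow_add]
    field_simp
  · intro n
    have := hypCoeff_pos d n
    positivity
  · intro n r hr
    exact rpow_nonneg (ht.trans hr).le _
  · exact fun n => integrableOn_Ioi_rpow_of_lt (by linarith [(n.cast_nonneg : (0 : ℝ) ≤ n)]) ht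
  · intro n
    rw [integral_Ioi_rpow_of_lt (by linarith [(n.cast_nonneg : (0 : ℝ) ≤ n)]) ht,
      show (-(2 * n + 2) + 1 : ℝ) = -((2 * n + 1 : ℕ) : ℝ) by push_cast; ring,
      rpow_neg ht.le, rpow_natCast, neg_div_neg_eq, one_div]
    push_cast
    rfl
  · simp_rw [hval]
    exact (tsum_hypCoeff hd).1.mul_left _

lemma integral_phiProfile {d : ℕ} (hd : 1 ≤ d) {t : ℝ} (ht : 0 < t) :
    ∫ r in Set.Ioi 0, r ^ (d - 1) * phiProfile d t r =
      phiConst d * (π / 2 * Gamma ((d : ℝ) / 2) * Gamma (1 + (d : ℝ) / 2) /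
        Gamma ((1 + (d : ℝ)) / 2) ^ 2) := by
  have hd0 : (0 : ℝ) < d := by exact_mod_cast hd
  have hC := phiConst_pos d
  have hp := hypCoeff_pos d
  obtain ⟨h1, h2, h3⟩ := tsum_hypCoeff hd
  have hin := integral_phiProfile_inner hd ht
  have hout := integral_phiProfile_outer hd ht
  have p1 : 0 < ∑' n : ℕ, hypCoeff d n / (2 * n + 1) :=
    h1.tsum_pos (fun n => by have := hp n; positivity) 0 (by have := hp 0; positivity)
  have p2 : 0 < ∑' n : ℕ, hypCoeff d n / (2 * n + d) :=
    h2.tsum_pos (fun n => by have := hp n; positivity) 0 (by have := hp 0; positivity)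
  rw [← integral_Ioc_eq_integral_Ioo] at hin
  have iin : IntegrableOn (fun r => r ^ (d - 1) * phiProfile d t r) (Set.Ioc 0 t) :=
    Integrable.of_integral_ne_zero (hin.trans_ne (by positivity))
  have iout : IntegrableOn (fun r => r ^ (d - 1) * phiProfile d t r) (Set.Ioi t) :=
    Integrable.of_integral_ne_zero (hout.trans_ne (by positivity))
  rw [← Set.Ioc_union_Ioi_eq_Ioi ht.le, setIntegral_union (Set.Ioc_disjoint_Ioi le_rfl)
    measurableSet_Ioi iin iout, hin, hout, ← h3]
  ring

lemma integral_phifun {d : ℕ} (hd : 1 ≤ d) {t : ℝ} (ht : 0 < t) :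
    ∫ x : EuclideanSpace ℝ (Fin d), phifun d t x = 1 := by
  have : NeZero d := ⟨by omega⟩
  have hd0 : (0 : ℝ) < d := by exact_mod_cast hd
  simp_rw [phifun_eq_phiProfile d ht]
  rw [integral_fun_norm_addHaar volume (phiProfile d t), finrank_euclideanSpace_fin]
  simp only [smul_eq_mul, nsmul_eq_mul]
  rw [integral_phiProfile hd ht, Measure.real, EuclideanSpace.volume_ball, Fintype.card_fin,
    ENNReal.ofReal_one, one_pow, one_mul, phiConst]
  have g1 := Gamma_pos_of_pos (s := (1 + (d : ℝ)) / 2) (by positivity)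
  have g2 := Gamma_pos_of_pos (s := (d : ℝ) / 2) (by positivity)
  have g3 : Gamma (1 + (d : ℝ) / 2) = d / 2 * Gamma ((d : ℝ) / 2) := by
    rw [add_comm, Gamma_add_one (by positivity)]
  have e1 : π ^ (1 + (d : ℝ) / 2) = π * √π ^ d := by
    rw [rpow_add pi_pos, rpow_one, sqrt_eq_rpow, ← rpow_natCast, ← rpow_mul pi_pos.le]
    ring_nf
  have hpi : 0 < √π := sqrt_pos.2 pi_pos
  rw [add_comm ((d : ℝ) / 2) 1, g3, e1, ENNReal.toReal_ofReal (by positivity)]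
  have := pi_pos
  field_simp

/-- For every integer `d ≥ 1` and every `t > 0`, the function `φ_t` is nonnegative,
integrable on `ℝ^d`, and `∫_{ℝ^d} φ_t(x) dx = 1`. -/
theorem statement8 (d : ℕ) (hd : 1 ≤ d) (t : ℝ) (ht : 0 < t) :
    (∀ x : EuclideanSpace ℝ (Fin d), 0 ≤ phifun d t x) ∧
    Integrable (phifun d t) (volume : Measure (EuclideanSpace ℝ (Fin d))) ∧
    ∫ x : EuclideanSpace ℝ (Fin d), phifun d t x = 1 := by
  refine ⟨fun x => ?_, ?_, integral_phifun hd ht⟩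
  · rw [phifun_eq_phiProfile d ht]
    exact phiProfile_nonneg d ht (norm_nonneg x)
  · exact Integrable.of_integral_ne_zero (by rw [integral_phifun hd ht]; exact one_ne_zero)
end
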